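/- arXiv:2009.14150 — 2 statements merged into one kernel-verified Lean document; each statement's English description precedes it below -/
import Mathlib

section
/- Let (X, d_X) and (Y, d_Y) be separable metric spaces and let θ be a Borel probability measure on X × Y whose marginals μ (on X) and ν (on Y) have finite first moments. Then the distance covariance dcov(θ) := ∫∫ d_μ(x,x')·d_ν(y,y') dθ((x,y)) dθ((x',y')) is a well-defined real number and satisfies |dcov(θ)| ≤ √( (∫∫ d_μ(x,x')² dθ dθ) · (∫∫ d_ν(y,y')² dθ dθ) ) < ∞. -/
open MeasureTheory

/-- The expected distance `a_μ(x) := ∫ d(x,x') dμ(x')`. -/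
noncomputable def expectedDist {X : Type*} [MetricSpace X] [MeasurableSpace X]
    (μ : Measure X) (x : X) : ℝ :=
  ∫ x', dist x x' ∂μ

/-- `D(μ) := ∫∫ d(x,x') dμ(x) dμ(x')`. -/
noncomputable def measureD {X : Type*} [MetricSpace X] [MeasurableSpace X]
    (μ : Measure X) : ℝ :=
  ∫ x, ∫ x', dist x x' ∂μ ∂μ

/-- The doubly centred distance `d_μ(x₁,x₂) := d(x₁,x₂) − a_μ(x₁) − a_μ(x₂) + D(μ)`. -/
noncomputable def centredDist {X : Type*} [MetricSpace X] [MeasurableSpace X]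
    (μ : Measure X) (x₁ x₂ : X) : ℝ :=
  dist x₁ x₂ - expectedDist μ x₁ - expectedDist μ x₂ + measureD μ

/-- The distance covariance
`dcov(θ) := ∫∫ d_μ(x,x')·d_ν(y,y') dθ((x,y)) dθ((x',y'))`, where `μ, ν` are the
marginals of `θ`. -/
noncomputable def dcov {X Y : Type*} [MetricSpace X] [MetricSpace Y]
    [MeasurableSpace X] [MeasurableSpace Y] (θ : Measure (X × Y)) : ℝ :=
  ∫ p : (X × Y) × (X × Y),
    centredDist (θ.map Prod.fst) p.1.1 p.2.1 * centredDist (θ.map Prod.snd) p.1.2 p.2.2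
    ∂(θ.prod θ)

section CentredDist

variable {X : Type*} [MetricSpace X] [MeasurableSpace X] {μ : Measure X}

lemma expectedDist_nonneg (x : X) : 0 ≤ expectedDist μ x :=
  integral_nonneg fun _ => dist_nonneg

lemma measureD_nonneg : 0 ≤ measureD μ :=
  integral_nonneg fun x => expectedDist_nonneg x

lemma centredDist_comm (x y : X) : centredDist μ x y = centredDist μ y x := by
  simp only [centredDist, dist_comm x y]
  ring

variable [BorelSpace X]

lemma measurable_dist_left (x : X) : Measurable fun y : X => dist x y :=
  (continuous_const.dist continuous_id).measurable

variable [IsProbabilityMeasure μ]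

lemma integrable_dist_of_exists (h : ∃ o : X, Integrable (fun x => dist o x) μ) (x : X) :
    Integrable (fun y => dist x y) μ := by
  obtain ⟨o, ho⟩ := h
  refine ((integrable_const (dist x o)).add ho).mono'
    (measurable_dist_left x).aestronglyMeasurable (.of_forall fun y => ?_)
  rw [Real.norm_of_nonneg dist_nonneg]
  exact dist_triangle x o y

lemma expectedDist_le_dist_add (h : ∃ o : X, Integrable (fun x => dist o x) μ) (x y : X) :
    expectedDist μ x ≤ dist x y + expectedDist μ y := by
  have hy := integrable_dist_of_exists h y
  calc expectedDist μ x ≤ ∫ z, (dist x y + dist y z) ∂μ :=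
        integral_mono (integrable_dist_of_exists h x) ((integrable_const _).add hy)
          fun z => dist_triangle x y z
    _ = dist x y + expectedDist μ y := by
        rw [integral_add (integrable_const _) hy]
        simp [expectedDist]

lemma dist_le_expectedDist_add (h : ∃ o : X, Integrable (fun x => dist o x) μ) (x y : X) :
    dist x y ≤ expectedDist μ x + expectedDist μ y := by
  have hx := integrable_dist_of_exists h x
  have hy := integrable_dist_of_exists h y
  calc dist x y = ∫ _, dist x y ∂μ := by simp
    _ ≤ ∫ z, (dist x z + dist y z) ∂μ :=
        integral_mono (integrable_const _) (hx.add hy) fun z => dist_triangle_right x y z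
    _ = expectedDist μ x + expectedDist μ y := integral_add hx hy

lemma continuous_expectedDist (h : ∃ o : X, Integrable (fun x => dist o x) μ) :
    Continuous (expectedDist μ) := by
  refine (LipschitzWith.of_le_add fun x y => ?_ : LipschitzWith 1 (expectedDist μ)).continuous
  linarith [expectedDist_le_dist_add h x y]

lemma integrable_expectedDist (h : ∃ o : X, Integrable (fun x => dist o x) μ) :
    Integrable (expectedDist μ) μ := by
  obtain ⟨o, ho⟩ := h
  refine (ho.add (integrable_const (expectedDist μ o))).mono'
    (continuous_expectedDist ⟨o, ho⟩).measurable.aestronglyMeasurable (.of_forall fun x => ?_)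
  rw [Real.norm_of_nonneg (expectedDist_nonneg x)]
  simpa [dist_comm o x] using expectedDist_le_dist_add ⟨o, ho⟩ x o

lemma measureD_le (h : ∃ o : X, Integrable (fun x => dist o x) μ) (x : X) :
    measureD μ ≤ 2 * expectedDist μ x := by
  have hx := integrable_dist_of_exists h x
  calc measureD μ ≤ ∫ z, (dist x z + expectedDist μ x) ∂μ :=
        integral_mono (integrable_expectedDist h) (hx.add (integrable_const _))
          fun z => dist_comm x z ▸ expectedDist_le_dist_add h z x
    _ = 2 * expectedDist μ x := by
        rw [integral_add hx (integrable_const _)]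
        simp [expectedDist, two_mul]

lemma abs_centredDist_le (h : ∃ o : X, Integrable (fun x => dist o x) μ) (x y : X) :
    |centredDist μ x y| ≤ 2 * expectedDist μ y := by
  have h₁ := expectedDist_le_dist_add h x y
  have h₂ := dist_le_expectedDist_add h x y
  have h₃ := measureD_le h y
  have h₄ := measureD_nonneg (μ := μ)
  rw [abs_le, centredDist]
  constructor <;> linarith

lemma centredDist_sq_le (h : ∃ o : X, Integrable (fun x => dist o x) μ) (x y : X) :
    centredDist μ x y ^ 2 ≤ 4 * (expectedDist μ x * expectedDist μ y) := by
  have hx : |centredDist μ x y| ≤ 2 * expectedDist μ x :=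
    centredDist_comm (μ := μ) x y ▸ abs_centredDist_le h y x
  calc centredDist μ x y ^ 2 = |centredDist μ x y| * |centredDist μ x y| := by
        rw [← sq, sq_abs]
    _ ≤ (2 * expectedDist μ x) * (2 * expectedDist μ y) :=
        mul_le_mul hx (abs_centredDist_le h x y) (abs_nonneg _) ((abs_nonneg _).trans hx)
    _ = 4 * (expectedDist μ x * expectedDist μ y) := by ring

variable [TopologicalSpace.SeparableSpace X]

lemma measurable_centredDist (h : ∃ o : X, Integrable (fun x => dist o x) μ) :
    Measurable fun p : X × X => centredDist μ p.1 p.2 := by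
  have := UniformSpace.secondCountable_of_separable X
  have ha := (continuous_expectedDist h).measurable
  exact ((measurable_dist.sub (ha.comp measurable_fst)).sub
    (ha.comp measurable_snd)).add_const _

lemma memLp_two_centredDist (h : ∃ o : X, Integrable (fun x => dist o x) μ) :
    MemLp (fun p : X × X => centredDist μ p.1 p.2) 2 (μ.prod μ) := by
  have hm := measurable_centredDist h
  have ha := integrable_expectedDist h
  refine (memLp_two_iff_integrable_sq hm.aestronglyMeasurable).2 ?_
  refine ((ha.mul_prod ha).const_mul 4).mono' (hm.pow_const 2).aestronglyMeasurable
    (.of_forall fun p => ?_)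
  rw [Real.norm_of_nonneg (sq_nonneg _)]
  exact centredDist_sq_le h p.1 p.2

lemma memLp_two_centredDist_map {Ω : Type*} [MeasurableSpace Ω] {θ : Measure Ω}
    [IsProbabilityMeasure θ] {f : Ω → X} (hf : Measurable f)
    (h : ∃ o : X, Integrable (fun x => dist o x) (θ.map f)) :
    MemLp (fun p : Ω × Ω => centredDist (θ.map f) (f p.1) (f p.2)) 2 (θ.prod θ) := by
  have := Measure.isProbabilityMeasure_map (μ := θ) hf.aemeasurable
  have hp := hf.measurePreserving θ
  exact (memLp_two_centredDist h).comp_measurePreserving (hp.prod hp)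

end CentredDist

lemma abs_integral_mul_le_sqrt {Ω : Type*} [MeasurableSpace Ω] {μ : Measure Ω} {f g : Ω → ℝ}
    (hf : MemLp f 2 μ) (hg : MemLp g 2 μ) :
    |∫ x, f x * g x ∂μ| ≤ √((∫ x, f x ^ 2 ∂μ) * ∫ x, g x ^ 2 ∂μ) := by
  have key := integral_mul_norm_le_Lp_mul_Lq (μ := μ) (f := f) (g := g)
    Real.HolderConjugate.two_two (by simpa using hf) (by simpa using hg)
  simp only [Real.norm_eq_abs, Real.rpow_two, sq_abs, ← Real.sqrt_eq_rpow] at key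
  rw [Real.sqrt_mul (integral_nonneg fun x => sq_nonneg (f x))]
  refine (abs_integral_le_integral_abs).trans ?_
  simpa only [abs_mul] using key

/-- For a Borel probability measure `θ` on the product of two separable
metric spaces whose marginals have finite first moments, `dcov(θ)` is a well-defined
real number (the integrand is `θ × θ`-integrable, as are the squares of the centred
distances) and
`|dcov(θ)| ≤ √( (∫∫ d_μ² dθdθ) · (∫∫ d_ν² dθdθ) )`. -/
theorem dcov_well_defined_and_bounded
    {X Y : Type*} [MetricSpace X] [MetricSpace Y]
    [TopologicalSpace.SeparableSpace X] [TopologicalSpace.SeparableSpace Y]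
    [MeasurableSpace X] [BorelSpace X] [MeasurableSpace Y] [BorelSpace Y]
    (θ : Measure (X × Y)) [IsProbabilityMeasure θ]
    (hμ : ∃ o : X, Integrable (fun x => dist o x) (θ.map Prod.fst))
    (hν : ∃ o : Y, Integrable (fun y => dist o y) (θ.map Prod.snd)) :
    Integrable
      (fun p : (X × Y) × (X × Y) =>
        centredDist (θ.map Prod.fst) p.1.1 p.2.1 *
          centredDist (θ.map Prod.snd) p.1.2 p.2.2) (θ.prod θ) ∧
    Integrable
      (fun p : (X × Y) × (X × Y) =>
        (centredDist (θ.map Prod.fst) p.1.1 p.2.1) ^ 2) (θ.prod θ) ∧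
    Integrable
      (fun p : (X × Y) × (X × Y) =>
        (centredDist (θ.map Prod.snd) p.1.2 p.2.2) ^ 2) (θ.prod θ) ∧
    |dcov θ| ≤
      Real.sqrt
        ((∫ p : (X × Y) × (X × Y),
            (centredDist (θ.map Prod.fst) p.1.1 p.2.1) ^ 2 ∂(θ.prod θ)) *
         (∫ p : (X × Y) × (X × Y),
            (centredDist (θ.map Prod.snd) p.1.2 p.2.2) ^ 2 ∂(θ.prod θ))) := by
  have hX := memLp_two_centredDist_map measurable_fst hμ
  have hY := memLp_two_centredDist_map measurable_snd hν
  exact ⟨hX.integrable_mul hY, hX.integrable_sq, hY.integrable_sq,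
    abs_integral_mul_le_sqrt hX hY⟩
end

section
/- Let (X, d) be a separable metric space of negative type, and let μ₁, μ₂ be Borel probability measures on X with finite first moments. Then D(μ₁ − μ₂) ≤ 0, where D(μ₁ − μ₂) := D(μ₁) + D(μ₂) − 2·∫∫ d(x,x') dμ₁(x) dμ₂(x') and D(μ) := ∫∫ d(x,x') dμ(x) dμ(x'). -/
open MeasureTheory

/-- A metric space has negative type if its metric is conditionally negative
definite. -/
def NegativeType (X : Type*) [MetricSpace X] : Prop :=
  ∀ n : ℕ, 1 ≤ n → ∀ x : Fin n → X, ∀ α : Fin n → ℝ, (∑ i : Fin n, α i) = 0 →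
    ∑ i : Fin n, ∑ j : Fin n, α i * α j * dist (x i) (x j) ≤ 0

/-- If a kernel has nonpositive sum over every finite family of points, then its integral
against the square of a probability measure is nonpositive. -/
theorem integral_prod_nonpos_of_sum_nonpos {Z : Type*} [MeasurableSpace Z]
    (ν : Measure Z) [IsProbabilityMeasure ν] (F : Z → Z → ℝ)
    (hF : Integrable (fun p : Z × Z => F p.1 p.2) (ν.prod ν))
    (hdiag : Integrable (fun z => F z z) ν)
    (hsum : ∀ (n : ℕ) (z : Fin n → Z), ∑ i, ∑ j, F (z i) (z j) ≤ 0) :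
    ∫ p, F p.1 p.2 ∂(ν.prod ν) ≤ 0 := by
  set T := ∫ p, F p.1 p.2 ∂(ν.prod ν)
  set C := ∫ z, F z z ∂ν
  have key (n : ℕ) : (n : ℝ) * T + C ≤ 0 := by
    let P : Measure (Fin (n + 1) → Z) := Measure.pi fun _ => ν
    have hpair {i j : Fin (n + 1)} (hij : i ≠ j) :
        MeasurePreserving (fun z : Fin (n + 1) → Z => (z i, z j)) P (ν.prod ν) := by
      refine ⟨by fun_prop, ?_⟩
      have hind : ProbabilityTheory.iIndepFun (fun i (z : Fin (n + 1) → Z) => z i) P :=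
        ProbabilityTheory.iIndepFun_pi (X := fun _ z => z) fun _ => aemeasurable_id
      rw [(ProbabilityTheory.indepFun_iff_map_prod_eq_prod_map_map
        (measurable_pi_apply i).aemeasurable (measurable_pi_apply j).aemeasurable).1
        (hind.indepFun hij)]
      congr 1
      · exact (measurePreserving_eval (fun _ : Fin (n + 1) => ν) i).map_eq
      · exact (measurePreserving_eval (fun _ : Fin (n + 1) => ν) j).map_eq
    have hval (i j : Fin (n + 1)) : Integrable (fun z => F (z i) (z j)) P ∧
        ∫ z, F (z i) (z j) ∂P = if i = j then C else T := by
      split_ifs with hij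
      · subst hij
        have hm := measurePreserving_eval (fun _ : Fin (n + 1) => ν) i
        refine ⟨hm.integrable_comp_of_integrable hdiag, ?_⟩
        have h := integral_map (μ := P) hm.measurable.aemeasurable
          (f := fun z => F z z) (by rw [hm.map_eq]; exact hdiag.aestronglyMeasurable)
        rw [hm.map_eq] at h
        exact h.symm
      · have hm := hpair hij
        refine ⟨hm.integrable_comp_of_integrable hF, ?_⟩
        have h := integral_map (μ := P) hm.measurable.aemeasurable
          (f := fun p : Z × Z => F p.1 p.2) (by rw [hm.map_eq]; exact hF.aestronglyMeasurable)
        rw [hm.map_eq] at h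
        exact h.symm
    have hle : ∫ z, ∑ i, ∑ j, F (z i) (z j) ∂P ≤ 0 := integral_nonpos fun z => hsum _ z
    rw [integral_finsetSum _ fun i _ => integrable_finsetSum _ fun j _ => (hval i j).1] at hle
    have hrow (i : Fin (n + 1)) : ∫ z, ∑ j, F (z i) (z j) ∂P = n * T + C := by
      rw [integral_finsetSum _ fun j _ => (hval i j).1]
      have h (j : Fin (n + 1)) : (if i = j then C else T) = (if i = j then C - T else 0) + T := by
        split_ifs <;> ring
      simp only [(hval i _).2, h, Finset.sum_add_distrib, Finset.sum_ite_eq, Finset.mem_univ,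
        if_true, Finset.sum_const, Finset.card_univ, Fintype.card_fin, nsmul_eq_mul]
      push_cast
      ring
    simp only [hrow, Finset.sum_const, Finset.card_univ, Fintype.card_fin, nsmul_eq_mul] at hle
    exact nonpos_of_mul_nonpos_right hle (by positivity)
  by_contra! hT
  obtain ⟨n, hn⟩ := exists_nat_gt (-C / T)
  rw [div_lt_iff₀ hT] at hn
  linarith [key n]

/-- In a space of negative type, the distances within two families of `n` points are
dominated by the distances between the families. -/
theorem NegativeType.sum_dist_nonpos {X : Type*} [MetricSpace X] (hX : NegativeType X)
    (n : ℕ) (x y : Fin n → X) :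
    ∑ i, ∑ j, (dist (x i) (x j) + dist (y i) (y j) - dist (x i) (y j) - dist (y i) (x j))
      ≤ 0 := by
  rcases Nat.eq_zero_or_pos n with rfl | hn
  · simp
  have h := hX (n + n) (by omega) (Fin.append x y)
    (Fin.append (fun _ => 1) (fun _ => -1)) (by
      simp only [Fin.sum_univ_add, Fin.append_left, Fin.append_right]
      simp)
  simp only [Fin.sum_univ_add, Fin.append_left, Fin.append_right] at h
  simp only [Finset.sum_add_distrib, Finset.sum_sub_distrib] at h ⊢
  simp only [one_mul, mul_one, neg_mul, mul_neg, neg_neg, Finset.sum_neg_distrib] at h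
  linarith

/-- The distance is integrable on a product of probability measures with finite first moments. -/
theorem integrable_dist_prod {X : Type*} [MetricSpace X]
    [TopologicalSpace.SeparableSpace X] [MeasurableSpace X] [BorelSpace X]
    (μ ν : Measure X) [IsProbabilityMeasure μ] [IsProbabilityMeasure ν]
    (hμ : ∃ o : X, Integrable (fun x => dist o x) μ)
    (hν : ∃ o : X, Integrable (fun x => dist o x) ν) :
    Integrable (fun p : X × X => dist p.1 p.2) (μ.prod ν) := by
  have : SecondCountableTopology X := UniformSpace.secondCountable_of_separable X
  obtain ⟨a, ha⟩ := hμ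
  obtain ⟨b, hb⟩ := hν
  refine (((ha.comp_fst ν).add (integrable_const (dist a b))).add (hb.comp_snd μ)).mono'
    (by fun_prop) (Filter.Eventually.of_forall fun p => ?_)
  simp only [Pi.add_apply, Real.norm_eq_abs, abs_of_nonneg dist_nonneg]
  calc dist p.1 p.2 ≤ dist p.1 a + dist a b + dist b p.2 := dist_triangle4 _ _ _ _
    _ = _ := by rw [dist_comm p.1 a]

/-- On a separable metric space of negative type, for Borel
probability measures `μ₁, μ₂` with finite first moments,
`D(μ₁ − μ₂) = D(μ₁) + D(μ₂) − 2 ∫∫ d dμ₁ dμ₂ ≤ 0`. -/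
theorem D_diff_nonpos_of_negativeType
    {X : Type*} [MetricSpace X] [TopologicalSpace.SeparableSpace X]
    [MeasurableSpace X] [BorelSpace X]
    (hX : NegativeType X)
    (μ₁ μ₂ : Measure X) [IsProbabilityMeasure μ₁] [IsProbabilityMeasure μ₂]
    (h₁ : ∃ o : X, Integrable (fun x => dist o x) μ₁)
    (h₂ : ∃ o : X, Integrable (fun x => dist o x) μ₂) :
    measureD μ₁ + measureD μ₂ - 2 * (∫ x, ∫ x', dist x x' ∂μ₂ ∂μ₁) ≤ 0 := by
  have : SecondCountableTopology X := UniformSpace.secondCountable_of_separable X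
  have i₁₁ := integrable_dist_prod μ₁ μ₁ h₁ h₁
  have i₂₂ := integrable_dist_prod μ₂ μ₂ h₂ h₂
  have i₁₂ := integrable_dist_prod μ₁ μ₂ h₁ h₂
  have i₂₁ := integrable_dist_prod μ₂ μ₁ h₂ h₁
  set ν := μ₁.prod μ₂
  have m₁ : MeasurePreserving Prod.fst ν μ₁ := measurePreserving_fst
  have m₂ : MeasurePreserving Prod.snd ν μ₂ := measurePreserving_snd
  have pull {ρ σ : Measure X} [IsProbabilityMeasure ρ] [IsProbabilityMeasure σ]
      {f g : X × X → X} (hf : MeasurePreserving f ν ρ)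
      (hg : MeasurePreserving g ν σ)
      (hi : Integrable (fun p : X × X => dist p.1 p.2) (ρ.prod σ)) :
      Integrable (fun p : (X × X) × (X × X) => dist (f p.1) (g p.2)) (ν.prod ν) ∧
      ∫ p, dist (f p.1) (g p.2) ∂(ν.prod ν) = ∫ x, ∫ y, dist x y ∂σ ∂ρ := by
    have hm := hf.prod hg
    refine ⟨hm.integrable_comp_of_integrable hi, ?_⟩
    have h := integral_map (μ := ν.prod ν) hm.measurable.aemeasurable
      (f := fun p : X × X => dist p.1 p.2) (by rw [hm.map_eq]; exact hi.aestronglyMeasurable)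
    rw [hm.map_eq, integral_prod _ hi] at h
    exact h.symm
  obtain ⟨j₁₁, e₁₁⟩ := pull m₁ m₁ i₁₁
  obtain ⟨j₂₂, e₂₂⟩ := pull m₂ m₂ i₂₂
  obtain ⟨j₁₂, e₁₂⟩ := pull m₁ m₂ i₁₂
  obtain ⟨j₂₁, e₂₁⟩ := pull m₂ m₁ i₂₁
  have hswap : ∫ x, ∫ y, dist x y ∂μ₁ ∂μ₂ = ∫ x, ∫ y, dist x y ∂μ₂ ∂μ₁ := by
    rw [integral_integral_swap i₂₁]
    simp only [dist_comm]
  have ja : Integrable (fun p : (X × X) × (X × X) =>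
      dist p.1.1 p.2.1 + dist p.1.2 p.2.2) (ν.prod ν) := j₁₁.add j₂₂
  have jb : Integrable (fun p : (X × X) × (X × X) =>
      dist p.1.1 p.2.1 + dist p.1.2 p.2.2 - dist p.1.1 p.2.2) (ν.prod ν) := ja.sub j₁₂
  have h := integral_prod_nonpos_of_sum_nonpos ν
    (fun z w => dist z.1 w.1 + dist z.2 w.2 - dist z.1 w.2 - dist z.2 w.1)
    (jb.sub j₂₁)
    (by
      have hd : Integrable (fun z : X × X => dist z.2 z.1) ν := by
        simpa only [dist_comm] using i₁₂
      refine (i₁₂.neg.sub hd).congr (Filter.Eventually.of_forall fun z => ?_)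
      simp)
    (fun n z => hX.sum_dist_nonpos n (fun i => (z i).1) (fun i => (z i).2))
  rw [integral_sub jb j₂₁, integral_sub ja j₁₂, integral_add j₁₁ j₂₂, e₁₁, e₂₂, e₁₂, e₂₁, hswap] at h
  unfold measureD
  linarith
end
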